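/- Let J be a real n×n matrix, ε > 0, η < 0, and Φ a real symmetric n×n matrix with εI ⪯ Φ ⪯ I and with −JᵀΦ − ΦJ + ηI positive semidefinite. Let x : ℝ → ℝⁿ be differentiable with x′(t) = J x(t) for all t. Then for all t ≥ 0, ‖x(t)‖² ≤ ε⁻¹ e^{ηt} ‖x(0)‖², where ‖·‖ is the Euclidean norm. In particular x(t) → 0 as t → ∞, and |η| is a lower bound on the exponential convergence rate of the post-disturbance trajectory. -/

import Mathlib

open Matrix Filter

theorem HasDerivAt.dotProduct_real {m : Type*} [Fintype m] {f g : ℝ → m → ℝ} {f' g' : m → ℝ}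
    {t : ℝ} (hf : HasDerivAt f f' t) (hg : HasDerivAt g g' t) :
    HasDerivAt (fun s => f s ⬝ᵥ g s) (f' ⬝ᵥ g t + f t ⬝ᵥ g') t := by
  rw [hasDerivAt_pi] at hf hg
  simp only [dotProduct, ← Finset.sum_add_distrib]
  exact HasDerivAt.fun_sum fun i _ => (hf i).mul (hg i)

theorem HasDerivAt.mulVec_real {m k : Type*} [Fintype m] [Fintype k] (A : Matrix k m ℝ)
    {f : ℝ → m → ℝ} {f' : m → ℝ} {t : ℝ} (hf : HasDerivAt f f' t) :
    HasDerivAt (fun s => A *ᵥ f s) (A *ᵥ f') t := by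
  rw [hasDerivAt_pi] at hf ⊢
  exact fun i => HasDerivAt.fun_sum (u := Finset.univ) fun j _ => (hf j).const_mul (A i j)

/-- Grönwall's inequality for the linear differential inequality `L' ≤ η L` on the whole line. -/
theorem le_exp_mul_of_deriv_le_mul {L L' : ℝ → ℝ} {η : ℝ} (hL : ∀ t, HasDerivAt L (L' t) t)
    (hle : ∀ t, L' t ≤ η * L t) {t : ℝ} (ht : 0 ≤ t) : L t ≤ Real.exp (η * t) * L 0 := by
  have hd : ∀ s, HasDerivAt (fun s => Real.exp (-(η * s)) * L s)
      (Real.exp (-(η * s)) * (L' s - η * L s)) s := fun s => by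
    have he : HasDerivAt (fun s => Real.exp (-(η * s))) (Real.exp (-(η * s)) * -(η * 1)) s :=
      ((hasDerivAt_id s).const_mul η).neg.exp
    exact (he.mul (hL s)).congr_deriv (by ring)
  have hanti : Antitone fun s => Real.exp (-(η * s)) * L s :=
    antitone_of_hasDerivAt_nonpos hd fun s =>
      mul_nonpos_of_nonneg_of_nonpos (Real.exp_pos _).le (sub_nonpos.2 (hle s))
  have h0 := mul_le_mul_of_nonneg_left (hanti ht) (Real.exp_pos (η * t)).le
  simpa [← mul_assoc, ← Real.exp_add] using h0

/-- **The stability index bounds the post-disturbance convergence rate.**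
If `ε > 0`, `η < 0`, the symmetric matrix `Φ` satisfies `εI ⪯ Φ ⪯ I` and
`−JᵀΦ − ΦJ + ηI ⪰ 0`, then every trajectory of `ẋ = Jx` satisfies
`‖x(t)‖² ≤ ε⁻¹ e^{ηt} ‖x(0)‖²` (Euclidean norm) for all `t ≥ 0`; in particular
`x(t) → 0` as `t → ∞`. -/
theorem stability_index_convergence_rate {n : ℕ}
    (J Φ : Matrix (Fin n) (Fin n) ℝ) (ε η : ℝ) (hε : 0 < ε) (hη : η < 0)
    (hΦsym : Φᵀ = Φ)
    (hlow : (Φ - ε • (1 : Matrix (Fin n) (Fin n) ℝ)).PosSemidef)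
    (hup : ((1 : Matrix (Fin n) (Fin n) ℝ) - Φ).PosSemidef)
    (h : (-(Jᵀ * Φ) - Φ * J + η • (1 : Matrix (Fin n) (Fin n) ℝ)).PosSemidef)
    (x : ℝ → Fin n → ℝ)
    (hx : ∀ t : ℝ, HasDerivAt x (J.mulVec (x t)) t) :
    (∀ t : ℝ, 0 ≤ t →
      ∑ i, (x t i) ^ 2 ≤ ε⁻¹ * Real.exp (η * t) * ∑ i, (x 0 i) ^ 2) ∧
    Tendsto x atTop (nhds 0) := by
  have hsq : ∀ v : Fin n → ℝ, ∑ i, v i ^ 2 = v ⬝ᵥ v := fun v => by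
    simp only [dotProduct, sq]
  have hlow' : ∀ v : Fin n → ℝ, ε * (v ⬝ᵥ v) ≤ v ⬝ᵥ Φ *ᵥ v := fun v => by
    have := hlow.dotProduct_mulVec_nonneg v
    simpa [sub_mulVec, smul_mulVec] using this
  have hup' : ∀ v : Fin n → ℝ, v ⬝ᵥ Φ *ᵥ v ≤ v ⬝ᵥ v := fun v => by
    have := hup.dotProduct_mulVec_nonneg v
    simpa [sub_mulVec] using this
  have hlyap : ∀ v : Fin n → ℝ,
      (J *ᵥ v) ⬝ᵥ Φ *ᵥ v + v ⬝ᵥ Φ *ᵥ (J *ᵥ v) ≤ η * (v ⬝ᵥ Φ *ᵥ v) := fun v => by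
    have h1 := h.dotProduct_mulVec_nonneg v
    have h2 : v ⬝ᵥ Jᵀ *ᵥ (Φ *ᵥ v) = (J *ᵥ v) ⬝ᵥ Φ *ᵥ v := by
      rw [dotProduct_mulVec, vecMul_transpose]
    simp only [star_trivial, add_mulVec, sub_mulVec, neg_mulVec, smul_mulVec, one_mulVec,
      dotProduct_add, dotProduct_sub, dotProduct_neg, dotProduct_smul, smul_eq_mul,
      ← mulVec_mulVec, h2] at h1
    linarith [mul_le_mul_of_nonpos_left (hup' v) hη.le]
  have hbound : ∀ t : ℝ, 0 ≤ t →
      ∑ i, (x t i) ^ 2 ≤ ε⁻¹ * Real.exp (η * t) * ∑ i, (x 0 i) ^ 2 := fun t ht => by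
    have hdecay := le_exp_mul_of_deriv_le_mul
      (fun s => (hx s).dotProduct_real ((hx s).mulVec_real Φ)) (fun s => hlyap (x s)) ht
    rw [hsq, hsq, mul_assoc, le_inv_mul_iff₀ hε]
    exact (hlow' _).trans
      (hdecay.trans (mul_le_mul_of_nonneg_left (hup' _) (Real.exp_pos _).le))
  refine ⟨hbound, tendsto_pi_nhds.2 fun i => ?_⟩
  have hexp : Tendsto (fun t => ε⁻¹ * Real.exp (η * t) * ∑ i, (x 0 i) ^ 2) atTop (nhds 0) := by
    have := Real.tendsto_exp_atBot.comp (tendsto_id.const_mul_atTop_of_neg hη)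
    simpa using (this.const_mul ε⁻¹).mul_const (∑ i, (x 0 i) ^ 2)
  have hsqi : Tendsto (fun t => x t i ^ 2) atTop (nhds 0) := by
    refine squeeze_zero' (Eventually.of_forall fun t => sq_nonneg _) ?_ hexp
    filter_upwards [eventually_ge_atTop 0] with t ht
    exact (Finset.single_le_sum (f := fun j => x t j ^ 2) (fun j _ => sq_nonneg _)
      (Finset.mem_univ i)).trans (hbound t ht)
  have habs := hsqi.sqrt
  simp only [Real.sqrt_sq_eq_abs, Real.sqrt_zero] at habs
  exact (tendsto_zero_iff_abs_tendsto_zero _).2 habs
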